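/- Let X be a topological space written as X = X₁ ∪ … ∪ X_r where each Xᵢ is locally closed in X. Let γ = max_i RK(Xᵢ) be the maximum of the Pillay ranks. Then RK(X) ≤ r·γ + (r − 1), where multiplication and addition are ordinal operations. -/

import Mathlib

/-- Auxiliary definition by well-founded recursion on ordinals. -/
noncomputable def PRankGeAux {X : Type u} [TopologicalSpace X] :
    Ordinal.{u} → Set X → Prop :=
  WellFounded.fix Ordinal.lt_wf fun α ih S =>
    S.Nonempty ∧ ∀ β (h : β < α), ∃ Y : Set X, Y ⊆ S ∧ Y = closure Y ∩ S ∧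
      (¬ ∃ U : Set X, IsOpen U ∧ (U ∩ S).Nonempty ∧ U ∩ S ⊆ closure Y) ∧ ih β h Y

/-- `PRankGe S α` expresses that the Pillay rank of the subset `S` (with its subspace
topology) is at least the ordinal `α`: `S` is nonempty, and for every `β < α` there is a
subset `Y ⊆ S` which is closed in `S` (i.e. `Y = closure Y ∩ S`), nowhere dense in `S`
(no nonempty relatively open subset of `S` is contained in the closure of `Y`), and of
rank at least `β`. -/
noncomputable def PRankGe {X : Type u} [TopologicalSpace X] (S : Set X)
    (α : Ordinal.{u}) : Prop :=
  PRankGeAux α S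

theorem PRankGe_iff {X : Type u} [TopologicalSpace X] (S : Set X) (α : Ordinal.{u}) :
    PRankGe S α ↔ (S.Nonempty ∧ ∀ β, β < α → ∃ Y : Set X, Y ⊆ S ∧ Y = closure Y ∩ S ∧
      (¬ ∃ U : Set X, IsOpen U ∧ (U ∩ S).Nonempty ∧ U ∩ S ⊆ closure Y) ∧ PRankGe Y β) := by
  unfold PRankGe
  conv_lhs => rw [PRankGeAux, WellFounded.fix_eq]
  rfl

theorem PRankGe.anti {X : Type u} [TopologicalSpace X] {S : Set X} {α β : Ordinal.{u}}
    (h : PRankGe S α) (hb : β ≤ α) : PRankGe S β := by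
  rw [PRankGe_iff] at h ⊢
  exact ⟨h.1, fun c hc => h.2 c (hc.trans_le hb)⟩

theorem PRankGe.mono {X : Type u} [TopologicalSpace X] {S T : Set X} {α : Ordinal.{u}}
    (h : PRankGe S α) (hST : S ⊆ T) (hcl : closure S ∩ T ⊆ S) : PRankGe T α := by
  rw [PRankGe_iff] at h ⊢
  refine ⟨h.1.mono hST, fun β hβ => ?_⟩
  obtain ⟨Y, hYS, hY, hn, hr⟩ := h.2 β hβ
  have key : closure Y ∩ T ⊆ Y := by
    rintro x ⟨hx, hxT⟩
    rw [hY]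
    exact ⟨hx, hcl ⟨closure_mono hYS hx, hxT⟩⟩
  refine ⟨Y, hYS.trans hST, ?_, ?_, hr⟩
  · exact Set.Subset.antisymm (fun x hx => ⟨subset_closure hx, hST (hYS hx)⟩) key
  · rintro ⟨U, hU, ⟨x, hxU, hxT⟩, hsub⟩
    refine hn ⟨U, hU, ⟨x, hxU, hYS (key ⟨hsub ⟨hxU, hxT⟩, hxT⟩)⟩, ?_⟩
    exact fun y hy => hsub ⟨hy.1, hST hy.2⟩

theorem PRankGe.mono_closed {X : Type u} [TopologicalSpace X] {S T : Set X} {α : Ordinal.{u}}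
    (h : PRankGe S α) (hST : S ⊆ T) (hcl : IsClosed S) : PRankGe T α :=
  h.mono hST (by rw [hcl.closure_eq]; exact Set.inter_subset_left)

theorem PRankGe_closed {X : Type u} [TopologicalSpace X] {S : Set X} (hS : IsClosed S)
    {α : Ordinal.{u}} (h : PRankGe S α) {β : Ordinal.{u}} (hβ : β < α) :
    ∃ Y : Set X, Y ⊆ S ∧ IsClosed Y ∧
      (∀ U : Set X, IsOpen U → (U ∩ S).Nonempty → ¬ U ∩ S ⊆ Y) ∧ PRankGe Y β := by
  rw [PRankGe_iff] at h
  obtain ⟨Y, hYS, hY, hn, hr⟩ := h.2 β hβ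
  have hc : IsClosed Y := by rw [hY]; exact isClosed_closure.inter hS
  refine ⟨Y, hYS, hc, fun U hU hne hsub => hn ⟨U, hU, hne, ?_⟩, hr⟩
  exact hsub.trans subset_closure

theorem PRankGe_zero {X : Type u} [TopologicalSpace X] {S : Set X} :
    PRankGe S (0 : Ordinal.{u}) ↔ S.Nonempty := by
  rw [PRankGe_iff]
  exact ⟨fun h => h.1, fun h => ⟨h, fun β hβ => absurd hβ (not_lt.2 zero_le)⟩⟩

/-- Rank of `closure W` from rank of traces of closed nowhere dense subsets. -/
theorem PRankGe_closure {X : Type u} [TopologicalSpace X] {S F : Set X} (hF : IsClosed F)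
    (α : Ordinal.{u}) (hne : (closure (S \ F)).Nonempty)
    (h : ∀ β, β < α → ∃ Y : Set X, IsClosed Y ∧
      (∀ U : Set X, IsOpen U → (U ∩ S).Nonempty → ¬ U ∩ S ⊆ Y) ∧
      PRankGe (Y ∩ closure (S \ F)) β) : PRankGe (closure (S \ F)) α := by
  rw [PRankGe_iff]
  refine ⟨hne, fun β hβ => ?_⟩
  obtain ⟨Y, hY, hn, hr⟩ := h β hβ
  have hc : IsClosed (Y ∩ closure (S \ F)) := hY.inter isClosed_closure
  refine ⟨_, Set.inter_subset_right, ?_, ?_, hr⟩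
  · rw [hc.closure_eq, Set.inter_assoc, Set.inter_self]
  · rintro ⟨U, hU, ⟨x, hxU, hx⟩, hsub⟩
    rw [hc.closure_eq] at hsub
    obtain ⟨y, hyU, hyS, hyF⟩ := mem_closure_iff.1 hx U hU hxU
    refine hn (U ∩ Fᶜ) (hU.inter hF.isOpen_compl) ⟨y, ⟨hyU, hyF⟩, hyS⟩ ?_
    rintro z ⟨⟨hzU, hzF⟩, hzS⟩
    exact (hsub ⟨hzU, subset_closure ⟨hzS, hzF⟩⟩).1

theorem PRankGe_union {X : Type u} [TopologicalSpace X] (α : Ordinal.{u}) :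
    ∀ C D : Set X, IsClosed C → IsClosed D → PRankGe (C ∪ D) α → PRankGe C α ∨ PRankGe D α := by
  induction α using Ordinal.induction with
  | h α ih =>
  intro C D hC hD h
  rcases eq_or_ne α 0 with rfl | hα
  · simpa only [PRankGe_zero, Set.union_nonempty] using h
  set C' := closure ((C ∪ D) \ D) with hC'
  set D' := closure ((C ∪ D) \ C') with hD'
  have hC'C : C' ⊆ C := closure_minimal (by rintro x ⟨hx | hx, hx'⟩ <;> tauto) hC
  have hD'D : D' ⊆ D := closure_minimal (by
    rintro x ⟨hx, hx'⟩
    by_contra hxD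
    exact hx' (subset_closure ⟨hx, hxD⟩)) hD
  have hcov : C ∪ D ⊆ C' ∪ D' := by
    intro x hx
    by_cases hx' : x ∈ C'
    · exact Or.inl hx'
    · exact Or.inr (subset_closure ⟨hx, hx'⟩)
  have hcC' : IsClosed C' := isClosed_closure
  have hcD' : IsClosed D' := isClosed_closure
  by_contra hcon
  push Not at hcon
  have h1 : ¬ PRankGe C' α := fun h => hcon.1 (h.mono_closed hC'C hcC')
  have h2 : ¬ PRankGe D' α := fun h => hcon.2 (h.mono_closed hD'D hcD')
  have pos : (0 : Ordinal.{u}) < α := pos_iff_ne_zero.2 hα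
  have e1 : ∃ β < α, ∀ Y : Set X, IsClosed Y →
      (∀ U : Set X, IsOpen U → (U ∩ (C ∪ D)).Nonempty → ¬ U ∩ (C ∪ D) ⊆ Y) →
      ¬ PRankGe (Y ∩ C') β := by
    by_contra hno
    push Not at hno
    refine h1 (PRankGe_closure hD α ?_ fun β hβ => ?_)
    · obtain ⟨Y, -, -, hr⟩ := hno 0 pos
      exact (PRankGe_zero.1 hr).mono Set.inter_subset_right
    · obtain ⟨Y, a, b, c⟩ := hno β hβ
      exact ⟨Y, a, b, c⟩
  have e2 : ∃ β < α, ∀ Y : Set X, IsClosed Y →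
      (∀ U : Set X, IsOpen U → (U ∩ (C ∪ D)).Nonempty → ¬ U ∩ (C ∪ D) ⊆ Y) →
      ¬ PRankGe (Y ∩ D') β := by
    by_contra hno
    push Not at hno
    refine h2 (PRankGe_closure hcC' α ?_ fun β hβ => ?_)
    · obtain ⟨Y, -, -, hr⟩ := hno 0 pos
      exact (PRankGe_zero.1 hr).mono Set.inter_subset_right
    · obtain ⟨Y, a, b, c⟩ := hno β hβ
      exact ⟨Y, a, b, c⟩
  obtain ⟨b1, hb1, e1⟩ := e1
  obtain ⟨b2, hb2, e2⟩ := e2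
  obtain ⟨Y, hYS, hY, hn, hr⟩ := PRankGe_closed (hC.union hD) h (max_lt hb1 hb2)
  have hYeq : Y = (Y ∩ C') ∪ (Y ∩ D') := by
    rw [← Set.inter_union_distrib_left]
    exact (Set.inter_eq_left.2 (hYS.trans hcov)).symm
  rw [hYeq] at hr
  rcases ih _ (max_lt hb1 hb2) _ _ (hY.inter hcC') (hY.inter hcD') hr with h | h
  · exact e1 Y hY hn (h.anti (le_max_left _ _))
  · exact e2 Y hY hn (h.anti (le_max_right _ _))

theorem PRankGe_biUnion {X : Type u} [TopologicalSpace X] {ι : Type*} (α : Ordinal.{u})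
    (C : ι → Set X) (hC : ∀ i, IsClosed (C i)) (s : Finset ι) :
    PRankGe (⋃ i ∈ s, C i) α → ∃ i ∈ s, PRankGe (C i) α := by
  classical
  induction s using Finset.induction_on with
  | empty =>
    intro h
    have := PRankGe_zero.1 (h.anti zero_le)
    simp at this
  | insert a s ha ih =>
    intro h
    rw [Finset.set_biUnion_insert] at h
    rcases PRankGe_union α _ _ (hC a) (s.finite_toSet.isClosed_biUnion fun i _ => hC i) h with h | h
    · exact ⟨a, Finset.mem_insert_self _ _, h⟩
    · obtain ⟨i, hi, h⟩ := ih h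
      exact ⟨i, Finset.mem_insert_of_mem hi, h⟩

theorem PRankGe_add {X : Type u} [TopologicalSpace X] (δ' δ : Ordinal.{u}) :
    ∀ S O : Set X, IsClosed S → IsOpen O → PRankGe S (δ' + δ) →
      PRankGe (S \ O) δ' ∨ PRankGe (S ∩ O) δ := by
  induction δ using Ordinal.induction with
  | h δ ih =>
  intro S O hS hO h
  by_contra hcon
  push Not at hcon
  obtain ⟨hA, hU⟩ := hcon
  have hAc : IsClosed (S \ O) := hS.sdiff hO
  have hTS : closure (S ∩ O) ⊆ S := closure_minimal Set.inter_subset_left hS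
  have hT : PRankGe (closure (S ∩ O)) (δ' + δ) := by
    have hSe : S = closure (S ∩ O) ∪ S \ O := by
      apply Set.Subset.antisymm
      · intro x hx
        by_cases hxO : x ∈ O
        · exact Or.inl (subset_closure ⟨hx, hxO⟩)
        · exact Or.inr ⟨hx, hxO⟩
      · exact Set.union_subset hTS Set.diff_subset
    rw [hSe] at h
    rcases PRankGe_union _ _ _ isClosed_closure hAc h with h | h
    · exact h
    · exact absurd (h.anti le_self_add) hA
  apply hU
  rw [PRankGe_iff]
  refine ⟨closure_nonempty_iff.1 (PRankGe_zero.1 (hT.anti zero_le)), fun β hβ => ?_⟩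
  obtain ⟨Y, hYT, hY, hn, hr⟩ := PRankGe_closed isClosed_closure hT
    (show δ' + β < δ' + δ from (add_lt_add_iff_left δ').2 hβ)
  rcases ih β hβ Y O hY hO hr with h' | h'
  · exact absurd (h'.mono_closed (Set.diff_subset_diff_left (hYT.trans hTS)) (hY.sdiff hO)) hA
  have hcl : closure (Y ∩ O) ⊆ Y := closure_minimal Set.inter_subset_left hY
  refine ⟨Y ∩ O, Set.inter_subset_inter_left _ (hYT.trans hTS), ?_, ?_, h'⟩
  · apply Set.Subset.antisymm
    · exact fun x hx => ⟨subset_closure hx, hTS (hYT hx.1), hx.2⟩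
    · exact fun x hx => ⟨hcl hx.1, hx.2.2⟩
  · rintro ⟨V, hV, ⟨x, hxV, hx⟩, hsub⟩
    refine hn (V ∩ O) (hV.inter hO) ⟨x, ⟨hxV, hx.2⟩, subset_closure hx⟩ ?_
    intro y hy
    have h3 := (hV.inter hO).inter_closure hy
    refine closure_minimal (fun z hz => hcl (hsub ⟨hz.1.1, hz.2⟩)) hY h3

theorem PRankGe_main {X : Type u} [TopologicalSpace X] {ι : Type*} (Xs : ι → Set X)
    (hlc : ∀ i, IsLocallyClosed (Xs i)) (δ : Ordinal.{u}) (hδ : ∀ i, ¬ PRankGe (Xs i) δ) (n : ℕ) :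
    ∀ (s : Finset ι) (S : Set X), s.card = n → IsClosed S → S ⊆ ⋃ i ∈ s, Xs i →
      ¬ PRankGe S (δ * (n : Ordinal.{u})) := by
  classical
  induction n with
  | zero =>
    intro s S hs _ hsub h
    obtain ⟨x, hx⟩ := PRankGe_zero.1 (h.anti zero_le)
    have := hsub hx
    rw [Finset.card_eq_zero] at hs
    simp [hs] at this
  | succ n ih =>
    intro s S hs hS hsub h
    have hSe : S = ⋃ i ∈ s, closure (Xs i ∩ S) := by
      apply Set.Subset.antisymm
      · intro x hx
        obtain ⟨i, hi, hxi⟩ := Set.mem_iUnion₂.1 (hsub hx)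
        exact Set.mem_iUnion₂.2 ⟨i, hi, subset_closure ⟨hxi, hx⟩⟩
      · exact Set.iUnion₂_subset fun i _ => closure_minimal Set.inter_subset_right hS
    rw [hSe] at h
    obtain ⟨i, hi, h⟩ := PRankGe_biUnion _ (fun i => closure (Xs i ∩ S))
      (fun _ => isClosed_closure) s h
    obtain ⟨O, Z, hO, hZ, hOZ⟩ := hlc i
    have hCS : closure (Xs i ∩ S) ⊆ S := closure_minimal Set.inter_subset_right hS
    have hCZ : closure (Xs i ∩ S) ⊆ Z :=
      closure_minimal (fun x hx => by rw [hOZ] at hx; exact hx.1.2) hZ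
    rw [Nat.cast_succ, mul_add, mul_one] at h
    rcases PRankGe_add _ _ _ O isClosed_closure hO h with h | h
    · refine ih (s.erase i) _ ?_ (isClosed_closure.sdiff hO) ?_ h
      · rw [Finset.card_erase_of_mem hi, hs]; rfl
      · rintro x ⟨hx, hxO⟩
        obtain ⟨j, hj, hxj⟩ := Set.mem_iUnion₂.1 (hsub (hCS hx))
        refine Set.mem_iUnion₂.2 ⟨j, Finset.mem_erase.2 ⟨?_, hj⟩, hxj⟩
        rintro rfl
        rw [hOZ] at hxj
        exact hxO hxj.1
    · refine hδ i (h.mono ?_ ?_)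
      · rintro x ⟨hx, hxO⟩
        rw [hOZ]
        exact ⟨hxO, hCZ hx⟩
      · rintro x ⟨hx, hxi⟩
        refine ⟨closure_minimal Set.inter_subset_left isClosed_closure hx, ?_⟩
        rw [hOZ] at hxi
        exact hxi.1

theorem ord_aux (γ : Ordinal.{u}) (r : ℕ) :
    (γ + 1) * (r : Ordinal.{u}) ≤ γ * (r : Ordinal.{u}) + (r : Ordinal.{u}) := by
  induction r with
  | zero => simp
  | succ n ih =>
    have hc : (n : Ordinal.{u}) + γ ≤ γ + n := by
      rcases lt_or_ge γ Ordinal.omega0 with h | h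
      · obtain ⟨m, rfl⟩ := Ordinal.lt_omega0.1 h
        exact_mod_cast (Nat.add_comm n m).le
      · rw [Ordinal.natCast_add_of_omega0_le h]
        exact le_self_add
    calc (γ + 1) * ((n + 1 : ℕ) : Ordinal.{u}) = (γ + 1) * n + (γ + 1) := by
          rw [Nat.cast_succ, mul_add, mul_one]
      _ ≤ γ * n + n + (γ + 1) := by gcongr
      _ = γ * n + (n + γ) + 1 := by simp only [add_assoc]
      _ ≤ γ * n + (γ + n) + 1 := by gcongr
      _ = _ := by rw [Nat.cast_succ, mul_add, mul_one]; simp only [add_assoc]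

/-- If the topological space `X` is the union of `r` subsets `X₁, …, X_r`, each locally
closed in `X`, and each of Pillay rank at most `γ`, then the Pillay rank of `X` is at
most `r·γ + (r − 1)` (with `r·γ` the ordinal `γ * r` and ordinal addition), i.e. `X`
does not have rank `≥ r·γ + (r − 1) + 1`. -/
theorem stmt10 {X : Type u} [TopologicalSpace X] (r : ℕ) (hr : 0 < r)
    (Xs : Fin r → Set X) (hcover : ⋃ i, Xs i = Set.univ)
    (hlc : ∀ i, IsLocallyClosed (Xs i)) (γ : Ordinal.{u})
    (hγ : ∀ i, ¬ PRankGe (Xs i) (γ + 1)) :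
    ¬ PRankGe (Set.univ : Set X) (γ * (r : Ordinal.{u}) + ((r - 1 : ℕ) : Ordinal.{u}) + 1) := by
  intro h
  refine PRankGe_main Xs hlc (γ + 1) hγ r Finset.univ Set.univ (by simp) isClosed_univ
    (by simp [hcover]) (h.anti ((ord_aux γ r).trans ?_))
  obtain ⟨k, rfl⟩ := Nat.exists_eq_succ_of_ne_zero hr.ne'
  simp [Nat.cast_succ, add_assoc]
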